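/- arXiv:2202.12035 — 8 statements merged into one kernel-verified Lean document; each statement's English description precedes it below -/
import Mathlib

section
/- Let A = (a_{ik}) ∈ ℝ^{m×n} define a zero-sum matrix game, and define a bisymmetric payoff tensor A' on Sym_m × Sym_n by A'_{iikk} = a_{ik} for 1 ≤ i ≤ m, 1 ≤ k ≤ n, and A'_{ijkl} = 0 whenever i ≠ j or k ≠ l. Then a pair (x,y) ∈ Δ_m × Δ_n is a pair of optimal strategies (a saddle point) for the matrix game if and only if there exists a pair of optimal strategies (a saddle point) (X,Y) ∈ 𝒳_m × 𝒳_n for the semidefinite zero-sum game with tensor A' such that X_{ii} = x_i for 1 ≤ i ≤ m and Y_{kk} = y_k for 1 ≤ k ≤ n. -/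
open Matrix BigOperators

/-- The spectraplex: real symmetric positive semidefinite `n×n` matrices with trace 1. -/
def Spectraplex (n : ℕ) : Set (Matrix (Fin n) (Fin n) ℝ) :=
  {X | X.IsSymm ∧ X.PosSemidef ∧ X.trace = 1}

/-- The payoff function of a semidefinite game with payoff tensor `A`. -/
def payoff {m n : ℕ} (A : Fin m → Fin m → Fin n → Fin n → ℝ)
    (X : Matrix (Fin m) (Fin m) ℝ) (Y : Matrix (Fin n) (Fin n) ℝ) : ℝ :=
  ∑ i, ∑ j, ∑ k, ∑ l, X i j * A i j k l * Y k l

/-- The diagonal matrix of a point of the standard simplex lies in the spectraplex. -/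
theorem diagonal_mem_spectraplex {n : ℕ} {x : Fin n → ℝ} (hx : x ∈ stdSimplex ℝ (Fin n)) :
    diagonal x ∈ Spectraplex n :=
  ⟨isSymm_diagonal x, PosSemidef.diagonal hx.1, by rw [trace_diagonal]; exact hx.2⟩

/-- The diagonal of a matrix in the spectraplex lies in the standard simplex. -/
theorem diag_mem_stdSimplex {n : ℕ} {X : Matrix (Fin n) (Fin n) ℝ} (hX : X ∈ Spectraplex n) :
    X.diag ∈ stdSimplex ℝ (Fin n) :=
  ⟨fun _ => hX.2.1.diag_nonneg, hX.2.2⟩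

/-- The payoff of a tensor supported on the diagonals depends only on the diagonals of the
strategies, and is the payoff of the underlying matrix game. -/
theorem payoff_eq_sum_diag {m n : ℕ} {a : Matrix (Fin m) (Fin n) ℝ}
    {A : Fin m → Fin m → Fin n → Fin n → ℝ}
    (hA : ∀ i j k l, A i j k l = if i = j ∧ k = l then a i k else 0)
    (X : Matrix (Fin m) (Fin m) ℝ) (Y : Matrix (Fin n) (Fin n) ℝ) :
    payoff A X Y = ∑ i, ∑ k, X.diag i * a i k * Y.diag k := by
  unfold payoff
  refine Finset.sum_congr rfl fun i _ => ?_
  rw [Finset.sum_eq_single i (fun j _ hj => by simp [hA, hj.symm]) (by simp)]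
  refine Finset.sum_congr rfl fun k _ => ?_
  rw [Finset.sum_eq_single k (fun l _ hl => by simp [hA, hl.symm]) (by simp)]
  simp [hA]

theorem matrix_game_embeds_into_semidefinite_game {m n : ℕ}
    (a : Matrix (Fin m) (Fin n) ℝ)
    (A' : Fin m → Fin m → Fin n → Fin n → ℝ)
    (hA' : ∀ i j k l, A' i j k l = if i = j ∧ k = l then a i k else 0)
    (x : Fin m → ℝ) (y : Fin n → ℝ)
    (hx : x ∈ stdSimplex ℝ (Fin m)) (hy : y ∈ stdSimplex ℝ (Fin n)) :
    ((∀ x' ∈ stdSimplex ℝ (Fin m),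
        ∑ i, ∑ k, x' i * a i k * y k ≤ ∑ i, ∑ k, x i * a i k * y k) ∧
     (∀ y' ∈ stdSimplex ℝ (Fin n),
        ∑ i, ∑ k, x i * a i k * y k ≤ ∑ i, ∑ k, x i * a i k * y' k))
    ↔
    (∃ X ∈ Spectraplex m, ∃ Y ∈ Spectraplex n,
      (∀ X' ∈ Spectraplex m, payoff A' X' Y ≤ payoff A' X Y) ∧
      (∀ Y' ∈ Spectraplex n, payoff A' X Y ≤ payoff A' X Y') ∧
      (∀ i, X i i = x i) ∧ (∀ k, Y k k = y k)) := by
  simp only [payoff_eq_sum_diag hA']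
  constructor
  · rintro ⟨h₁, h₂⟩
    refine ⟨diagonal x, diagonal_mem_spectraplex hx, diagonal y, diagonal_mem_spectraplex hy,
      fun X' hX' => ?_, fun Y' hY' => ?_, diagonal_apply_eq x, diagonal_apply_eq y⟩
    · simpa only [diag_diagonal] using h₁ X'.diag (diag_mem_stdSimplex hX')
    · simpa only [diag_diagonal] using h₂ Y'.diag (diag_mem_stdSimplex hY')
  · rintro ⟨X, -, Y, -, h₁, h₂, hXx, hYy⟩
    obtain rfl : X.diag = x := funext hXx
    obtain rfl : Y.diag = y := funext hYy
    refine ⟨fun x' hx' => ?_, fun y' hy' => ?_⟩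
    · simpa only [diag_diagonal] using h₁ (diagonal x') (diagonal_mem_spectraplex hx')
    · simpa only [diag_diagonal] using h₂ (diagonal y') (diagonal_mem_spectraplex hy')
end

section
/- Let A be a bisymmetric payoff tensor on Sym_m × Sym_n. For every X ∈ 𝒳_m, the infimum inf_{Y∈𝒳_n} p_A(X,Y) is attained and equals the greatest real number v₁ such that A(X) − v₁·I_n is positive semidefinite. Consequently, the maximin value sup_{X∈𝒳_m} inf_{Y∈𝒳_n} p_A(X,Y) equals the optimal value of the semidefinite program max{ v₁ : X ∈ 𝒳_m, v₁ ∈ ℝ, A(X) − v₁·I_n ⪰ 0 }, and this optimal value is attained. -/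
open Matrix BigOperators

/-- A bisymmetric payoff tensor. -/
def Bisymm {m n : ℕ} (A : Fin m → Fin m → Fin n → Fin n → ℝ) : Prop :=
  ∀ i j k l, A i j k l = A j i k l ∧ A i j k l = A i j l k

/-- The slice matrix `A(X) ∈ Sym_n`, with entries `A(X)_{kl} = Σ_{i,j} X_{ij} A_{ijkl}`. -/
def sliceX {m n : ℕ} (A : Fin m → Fin m → Fin n → Fin n → ℝ)
    (X : Matrix (Fin m) (Fin m) ℝ) : Matrix (Fin n) (Fin n) ℝ :=
  Matrix.of fun k l => ∑ i, ∑ j, X i j * A i j k l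

theorem payoff_eq_trace {m n : ℕ} (A : Fin m → Fin m → Fin n → Fin n → ℝ)
    (X : Matrix (Fin m) (Fin m) ℝ) {Y : Matrix (Fin n) (Fin n) ℝ} (hY : Y.IsSymm) :
    payoff A X Y = (sliceX A X * Y).trace := by
  have h : ∀ k l, (∑ i, ∑ j, X i j * A i j k l) * Y l k =
      ∑ i, ∑ j, X i j * A i j k l * Y k l := by
    intro k l
    simp_rw [Finset.sum_mul, hY.apply k l]
  simp only [payoff, Matrix.trace, Matrix.diag, Matrix.mul_apply, sliceX, Matrix.of_apply, h]
  calc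
    _ = ∑ i, ∑ k, ∑ j, ∑ l, X i j * A i j k l * Y k l :=
      Finset.sum_congr rfl fun i _ => Finset.sum_comm
    _ = ∑ k, ∑ i, ∑ j, ∑ l, X i j * A i j k l * Y k l := Finset.sum_comm
    _ = ∑ k, ∑ i, ∑ l, ∑ j, X i j * A i j k l * Y k l :=
      Finset.sum_congr rfl fun k _ => Finset.sum_congr rfl fun i _ => Finset.sum_comm
    _ = _ := Finset.sum_congr rfl fun k _ => Finset.sum_comm

theorem sliceX_isSymm {m n : ℕ} {A : Fin m → Fin m → Fin n → Fin n → ℝ} (hA : Bisymm A)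
    (X : Matrix (Fin m) (Fin m) ℝ) : (sliceX A X).IsSymm := by
  ext k l
  simp only [sliceX, Matrix.transpose_apply, Matrix.of_apply]
  exact Finset.sum_congr rfl fun i _ => Finset.sum_congr rfl fun j _ => by rw [(hA i j l k).2]

open scoped MatrixOrder ComplexOrder in
theorem Matrix.PosSemidef.trace_mul_nonneg {n : Type*} [Fintype n] [DecidableEq n]
    {M N : Matrix n n ℝ} (hM : M.PosSemidef) (hN : N.PosSemidef) : 0 ≤ (M * N).trace := by
  obtain ⟨B, rfl⟩ := CStarAlgebra.nonneg_iff_eq_star_mul_self.mp hN.nonneg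
  rw [Matrix.star_eq_conjTranspose, ← Matrix.mul_assoc, Matrix.trace_mul_comm, ← Matrix.mul_assoc]
  exact (hM.mul_mul_conjTranspose_same B).trace_nonneg

theorem Matrix.PosSemidef.diag_le_trace {n : Type*} [Fintype n] {M : Matrix n n ℝ}
    (hM : M.PosSemidef) (i : n) : M i i ≤ M.trace :=
  Finset.single_le_sum (f := fun i => M i i) (fun _ _ => hM.diag_nonneg) (Finset.mem_univ i)

theorem Matrix.PosSemidef.abs_apply_le_trace {n : Type*} [Fintype n] [DecidableEq n]
    {M : Matrix n n ℝ} (hM : M.PosSemidef) (i j : n) : |M i j| ≤ M.trace := by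
  have hs : M j i = M i j := by simpa using hM.isHermitian.apply i j
  have h₁ := hM.dotProduct_mulVec_nonneg (Pi.single i 1 + Pi.single j 1)
  have h₂ := hM.dotProduct_mulVec_nonneg (Pi.single i 1 - Pi.single j 1)
  simp [Matrix.mulVec_add, Matrix.mulVec_sub, add_dotProduct, sub_dotProduct, hs] at h₁ h₂
  have hi := hM.diag_le_trace i
  have hj := hM.diag_le_trace j
  rw [abs_le]
  constructor <;> linarith

theorem Spectraplex.isClosed (n : ℕ) : IsClosed (Spectraplex n) := by
  have h : Spectraplex n = {X | Xᵀ = X} ∩ ((⋂ x : Fin n → ℝ, {X | 0 ≤ x ⬝ᵥ (X *ᵥ x)}) ∩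
      {X | X.trace = 1}) := by
    ext X
    simp only [Spectraplex, Matrix.posSemidef_iff_dotProduct_mulVec, Matrix.IsSymm,
      Matrix.IsHermitian, Matrix.conjTranspose_eq_transpose_of_trivial, star_trivial,
      Set.mem_ofPred_eq, Set.mem_inter_iff, Set.mem_iInter]
    tauto
  rw [h]
  refine (isClosed_eq (by fun_prop) continuous_id).inter (IsClosed.inter
    (isClosed_iInter fun x => isClosed_le continuous_const ?_)
    (isClosed_eq (by fun_prop) continuous_const))
  fun_prop

theorem Spectraplex.isCompact (n : ℕ) : IsCompact (Spectraplex n) := by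
  have hc : IsCompact (Set.univ.pi fun _ : Fin n => Set.univ.pi fun _ : Fin n =>
      Set.Icc (-1 : ℝ) 1) :=
    isCompact_univ_pi fun _ => isCompact_univ_pi fun _ => isCompact_Icc
  refine hc.of_isClosed_subset (Spectraplex.isClosed n) fun X hX i _ j _ => ?_
  exact abs_le.1 ((hX.2.1.abs_apply_le_trace i j).trans hX.2.2.le)

theorem Spectraplex.vecMulVec_mem {n : ℕ} {x : Fin n → ℝ} (hx : x ≠ 0) :
    (x ⬝ᵥ x)⁻¹ • Matrix.vecMulVec x x ∈ Spectraplex n := by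
  have hpos : 0 < x ⬝ᵥ x := by simpa using Matrix.dotProduct_star_self_pos_iff.2 hx
  have hp : ((x ⬝ᵥ x)⁻¹ • Matrix.vecMulVec x x).PosSemidef := by
    simpa using (Matrix.posSemidef_vecMulVec_self_star x).smul (inv_nonneg.2 hpos.le)
  refine ⟨by simpa using hp.isHermitian, hp, ?_⟩
  rw [Matrix.trace_smul, Matrix.trace_vecMulVec, smul_eq_mul, inv_mul_cancel₀ hpos.ne']

theorem Spectraplex.nonempty {n : ℕ} (hn : 1 ≤ n) : (Spectraplex n).Nonempty :=
  have : NeZero n := ⟨by omega⟩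
  ⟨_, Spectraplex.vecMulVec_mem (x := fun _ => 1) fun h => one_ne_zero (congrFun h 0)⟩

theorem posSemidef_sliceX_sub_iff {m n : ℕ} {A : Fin m → Fin m → Fin n → Fin n → ℝ}
    (hA : Bisymm A) (X : Matrix (Fin m) (Fin m) ℝ) (v : ℝ) :
    (sliceX A X - v • (1 : Matrix (Fin n) (Fin n) ℝ)).PosSemidef ↔
      ∀ Y ∈ Spectraplex n, v ≤ payoff A X Y := by
  constructor
  · intro h Y hY
    have := h.trace_mul_nonneg hY.2.1
    rw [Matrix.sub_mul, Matrix.smul_mul, Matrix.one_mul, Matrix.trace_sub, Matrix.trace_smul,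
      hY.2.2, ← payoff_eq_trace A X hY.1, smul_eq_mul, mul_one] at this
    linarith
  · intro h
    refine Matrix.PosSemidef.of_dotProduct_mulVec_nonneg ?_ fun x => ?_
    · have := sliceX_isSymm hA X
      rw [Matrix.IsSymm] at this
      simp [Matrix.IsHermitian, Matrix.conjTranspose_eq_transpose_of_trivial, this]
    · obtain rfl | hx := eq_or_ne x 0
      · simp
      have hpos : 0 < x ⬝ᵥ x := by simpa using Matrix.dotProduct_star_self_pos_iff.2 hx
      have hmem := Spectraplex.vecMulVec_mem hx
      have hv := h _ hmem
      rw [payoff_eq_trace A X hmem.1, Matrix.mul_smul, Matrix.trace_smul, Matrix.mul_vecMulVec,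
        Matrix.trace_vecMulVec, smul_eq_mul, inv_mul_eq_div, le_div_iff₀ hpos] at hv
      rw [star_trivial, Matrix.sub_mulVec, Matrix.smul_mulVec, Matrix.one_mulVec, dotProduct_sub,
        dotProduct_smul, smul_eq_mul, dotProduct_comm x]
      linarith

theorem continuous_payoff {m n : ℕ} (A : Fin m → Fin m → Fin n → Fin n → ℝ) :
    Continuous fun p : Matrix (Fin m) (Fin m) ℝ × Matrix (Fin n) (Fin n) ℝ =>
      payoff A p.1 p.2 := by
  unfold payoff
  fun_prop

theorem exists_payoff_eq_iInf {m n : ℕ} (hn : 1 ≤ n) (A : Fin m → Fin m → Fin n → Fin n → ℝ)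
    (X : Matrix (Fin m) (Fin m) ℝ) :
    ∃ Y ∈ Spectraplex n, payoff A X Y = ⨅ Y' : Spectraplex n, payoff A X Y'.1 := by
  obtain ⟨Y, hY, h⟩ := (Spectraplex.isCompact n).exists_sInf_image_eq (Spectraplex.nonempty hn)
    ((continuous_payoff A).comp (Continuous.prodMk_right X)).continuousOn
  rw [sInf_image'] at h
  exact ⟨Y, hY, h.symm⟩

theorem iInf_payoff_le {m n : ℕ} (A : Fin m → Fin m → Fin n → Fin n → ℝ)
    (X : Matrix (Fin m) (Fin m) ℝ) {Y : Matrix (Fin n) (Fin n) ℝ} (hY : Y ∈ Spectraplex n) :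
    ⨅ Y' : Spectraplex n, payoff A X Y'.1 ≤ payoff A X Y := by
  have h := (Spectraplex.isCompact n).bddBelow_image
    ((continuous_payoff A).comp (Continuous.prodMk_right X)).continuousOn
  rw [Set.image_eq_range] at h
  exact ciInf_le h ⟨Y, hY⟩

theorem isGreatest_iInf_payoff {m n : ℕ} (hn : 1 ≤ n)
    {A : Fin m → Fin m → Fin n → Fin n → ℝ} (hA : Bisymm A) (X : Matrix (Fin m) (Fin m) ℝ) :
    IsGreatest {v₁ : ℝ | (sliceX A X - v₁ • (1 : Matrix (Fin n) (Fin n) ℝ)).PosSemidef}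
      (⨅ Y : Spectraplex n, payoff A X Y.1) := by
  have := (Spectraplex.nonempty hn).to_subtype
  exact ⟨(posSemidef_sliceX_sub_iff hA X _).2 fun Y hY => iInf_payoff_le A X hY,
    fun v hv => le_ciInf fun Y => (posSemidef_sliceX_sub_iff hA X v).1 hv Y.1 Y.2⟩

theorem continuous_iInf_payoff {m n : ℕ} (A : Fin m → Fin m → Fin n → Fin n → ℝ) :
    Continuous fun X => ⨅ Y : Spectraplex n, payoff A X Y.1 := by
  have h := (Spectraplex.isCompact n).continuous_sInf (f := payoff A) (continuous_payoff A)
  simpa only [sInf_image'] using h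

theorem maximin_as_semidefinite_program {m n : ℕ} (hm : 1 ≤ m) (hn : 1 ≤ n)
    (A : Fin m → Fin m → Fin n → Fin n → ℝ) (hA : Bisymm A) :
    (∀ X ∈ Spectraplex m,
      IsGreatest {v₁ : ℝ | (sliceX A X - v₁ • (1 : Matrix (Fin n) (Fin n) ℝ)).PosSemidef}
        (⨅ Y : Spectraplex n, payoff A X Y.1) ∧
      ∃ Y ∈ Spectraplex n, payoff A X Y = ⨅ Y' : Spectraplex n, payoff A X Y'.1) ∧
    IsGreatest
      {v₁ : ℝ | ∃ X ∈ Spectraplex m,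
        (sliceX A X - v₁ • (1 : Matrix (Fin n) (Fin n) ℝ)).PosSemidef}
      (⨆ X : Spectraplex m, ⨅ Y : Spectraplex n, payoff A X.1 Y.1) := by
  refine ⟨fun X _ => ⟨isGreatest_iInf_payoff hn hA X, exists_payoff_eq_iInf hn A X⟩, ?_⟩
  have := (Spectraplex.nonempty hm).to_subtype
  obtain ⟨X₀, hX₀, hmax⟩ := (Spectraplex.isCompact m).exists_isMaxOn (Spectraplex.nonempty hm)
    (continuous_iInf_payoff A).continuousOn
  have hsup : ⨆ X : Spectraplex m, ⨅ Y : Spectraplex n, payoff A X.1 Y.1 =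
      ⨅ Y : Spectraplex n, payoff A X₀ Y.1 :=
    le_antisymm (ciSup_le fun X => hmax X.2)
      (le_ciSup (f := fun X : Spectraplex m => ⨅ Y : Spectraplex n, payoff A X.1 Y.1)
        ⟨_, Set.forall_mem_range.2 fun X => hmax X.2⟩ ⟨X₀, hX₀⟩)
  rw [hsup]
  refine ⟨⟨X₀, hX₀, (isGreatest_iInf_payoff hn hA X₀).1⟩, ?_⟩
  rintro v ⟨X, hX, hv⟩
  exact ((isGreatest_iInf_payoff hn hA X).2 hv).trans (hmax hX)
end

section
/- Let A₁, …, A_m, C ∈ Sym_n and b ∈ ℝ^m, and let (ȳ, X̄, t̄) with ȳ ∈ ℝ^m, X̄ ∈ Sym_n, t̄ ∈ ℝ be a solution of the associated semidefinite Dantzig game, i.e., ȳ ≥ 0 componentwise, X̄ ⪰ 0, t̄ ≥ 0, 𝟙ᵀȳ + tr(X̄) + t̄ = 1, and (i) ⟨A_i, X̄⟩ − b_i t̄ ≥ 0 for all 1 ≤ i ≤ m, (ii) t̄·C − Σ_{j=1}^m ȳ_j A_j ⪰ 0, (iii) bᵀȳ − ⟨C, X̄⟩ ≥ 0. Then t̄·(bᵀȳ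 − ⟨C, X̄⟩) = 0. -/
open Matrix BigOperators

/-- The Frobenius inner product `⟨M, N⟩ = Σ_{i,j} M_{ij} N_{ij}`. -/
def frob {n : ℕ} (M N : Matrix (Fin n) (Fin n) ℝ) : ℝ :=
  ∑ i, ∑ j, M i j * N i j

theorem frob_eq_trace_mul {n : ℕ} {M N : Matrix (Fin n) (Fin n) ℝ} (hN : N.IsSymm) :
    frob M N = (M * N).trace := by
  simp only [frob, Matrix.trace, Matrix.diag_apply, Matrix.mul_apply]
  refine Finset.sum_congr rfl fun i _ => Finset.sum_congr rfl fun j _ => ?_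
  rw [hN.apply]

theorem frob_nonneg_of_posSemidef {n : ℕ} {M N : Matrix (Fin n) (Fin n) ℝ}
    (hM : M.PosSemidef) (hN : N.PosSemidef) : 0 ≤ frob M N := by
  have h := (hM.hadamard hN).dotProduct_mulVec_nonneg 1
  simpa [frob, dotProduct, Matrix.mulVec] using h

theorem frob_smul_sub_sum_smul {m n : ℕ} (t : ℝ) (y : Fin m → ℝ)
    (A : Fin m → Matrix (Fin n) (Fin n) ℝ) (C : Matrix (Fin n) (Fin n) ℝ)
    {X : Matrix (Fin n) (Fin n) ℝ} (hX : X.IsSymm) :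
    frob (t • C - ∑ j, y j • A j) X = t * frob C X - ∑ j, y j * frob (A j) X := by
  simp only [frob_eq_trace_mul hX, Matrix.sub_mul, Matrix.sum_mul, Matrix.smul_mul,
    Matrix.trace_sub, Matrix.trace_sum, Matrix.trace_smul, smul_eq_mul]

theorem dantzig_game_complementarity {m n : ℕ}
    (A : Fin m → Matrix (Fin n) (Fin n) ℝ) (C : Matrix (Fin n) (Fin n) ℝ)
    (b : Fin m → ℝ)
    (hAsym : ∀ i, (A i).IsSymm) (hCsym : C.IsSymm)
    (ybar : Fin m → ℝ) (Xbar : Matrix (Fin n) (Fin n) ℝ) (tbar : ℝ)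
    (hy : ∀ i, 0 ≤ ybar i) (hX : Xbar.PosSemidef) (ht : 0 ≤ tbar)
    (htr : (∑ i, ybar i) + Xbar.trace + tbar = 1)
    (h1 : ∀ i, 0 ≤ frob (A i) Xbar - b i * tbar)
    (h2 : (tbar • C - ∑ j, ybar j • A j).PosSemidef)
    (h3 : 0 ≤ (∑ i, b i * ybar i) - frob C Xbar) :
    tbar * ((∑ i, b i * ybar i) - frob C Xbar) = 0 := by
  have hXs : Xbar.IsSymm := by simpa [Matrix.IsHermitian, Matrix.IsSymm] using hX.isHermitian
  have hslack := frob_nonneg_of_posSemidef h2 hX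
  rw [frob_smul_sub_sum_smul tbar ybar A C hXs] at hslack
  have hsum : tbar * ∑ i, b i * ybar i ≤ ∑ i, ybar i * frob (A i) Xbar := by
    rw [Finset.mul_sum]
    refine Finset.sum_le_sum fun i _ => ?_
    nlinarith [mul_nonneg (hy i) (h1 i)]
  refine le_antisymm ?_ (mul_nonneg ht h3)
  rw [mul_sub]
  linarith
end

section
/- Characterization of Nash equilibria of semidefinite games: let (A, B) be bisymmetric payoff tensors on Sym_m × Sym_n, let X, Y be matrices and u, v ∈ ℝ. Then the quadruple (X, Y, u, v) represents a Nash equilibrium of the semidefinite game (i.e., X ∈ 𝒳_m, Y ∈ 𝒳_n, u = p_A(X,Y), v = p_B(X,Y), p_A(X',Y) ≤ u for all X' ∈ 𝒳_m, and p_B(X,Y') ≤ v for all Y' ∈ 𝒳_n) if and only if the following three conditions hold: (1) X ∈ 𝒳_m and p_B(X,Y') ≤ v for all Y' ∈ 𝒳_n; (2) Y ∈ 𝒳_n and p_A(X',Y) ≤ u for all X' ∈ 𝒳_m; (3) for every finite rank-1 decomposition X = Σ_s λ_s p⁽ˢ⁾(p⁽ˢ⁾)ᵀ and Y = Σ_t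 μ_t q⁽ᵗ⁾(q⁽ᵗ⁾)ᵀ with λ_s, μ_t > 0, ‖p⁽ˢ⁾‖ = ‖q⁽ᵗ⁾‖ = 1, Σ_s λ_s = Σ_t μ_t = 1, one has p_B(X, q⁽ᵗ⁾(q⁽ᵗ⁾)ᵀ) = v for all t and p_A(p⁽ˢ⁾(p⁽ˢ⁾)ᵀ, Y) = u for all s. -/
open Matrix BigOperators

theorem payoff_eq_sum_prod {m n : ℕ} (A : Fin m → Fin m → Fin n → Fin n → ℝ)
    (X : Matrix (Fin m) (Fin m) ℝ) (Y : Matrix (Fin n) (Fin n) ℝ) :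
    payoff A X Y = ∑ x : Fin m × Fin m × Fin n × Fin n,
      X x.1 x.2.1 * A x.1 x.2.1 x.2.2.1 x.2.2.2 * Y x.2.2.1 x.2.2.2 := by
  simp only [payoff, Fintype.sum_prod_type]

theorem payoff_sum_left {m n : ℕ} {ι : Type*} [Fintype ι]
    (A : Fin m → Fin m → Fin n → Fin n → ℝ) (w : ι → ℝ)
    (P : ι → Matrix (Fin m) (Fin m) ℝ) (Y : Matrix (Fin n) (Fin n) ℝ) :
    payoff A (∑ s, w s • P s) Y = ∑ s, w s * payoff A (P s) Y := by
  simp only [payoff_eq_sum_prod, Matrix.sum_apply, Matrix.smul_apply, smul_eq_mul,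
    Finset.mul_sum, Finset.sum_mul, mul_assoc]
  exact Finset.sum_comm

theorem payoff_sum_right {m n : ℕ} {ι : Type*} [Fintype ι]
    (A : Fin m → Fin m → Fin n → Fin n → ℝ) (w : ι → ℝ)
    (X : Matrix (Fin m) (Fin m) ℝ) (Q : ι → Matrix (Fin n) (Fin n) ℝ) :
    payoff A X (∑ t, w t • Q t) = ∑ t, w t * payoff A X (Q t) := by
  simp only [payoff_eq_sum_prod, Matrix.sum_apply, Matrix.smul_apply, smul_eq_mul,
    Finset.mul_sum, mul_left_comm (w _)]
  exact Finset.sum_comm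

theorem vecMulVec_self_mem_spectraplex {n : ℕ} {p : Fin n → ℝ} (hp : ∑ i, p i ^ 2 = 1) :
    Matrix.vecMulVec p p ∈ Spectraplex n := by
  refine ⟨?_, ?_, ?_⟩
  · ext i j
    simp [Matrix.vecMulVec_apply, mul_comm]
  · simpa using Matrix.posSemidef_vecMulVec_self_star p
  · simpa [Matrix.trace, Matrix.vecMulVec_apply, pow_two] using hp

theorem exists_rank_one_decomposition {n : ℕ} {X : Matrix (Fin n) (Fin n) ℝ}
    (hX : X ∈ Spectraplex n) :
    ∃ (N : ℕ) (w : Fin N → ℝ) (p : Fin N → Fin n → ℝ),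
      (∀ s, 0 < w s) ∧ (∀ s, ∑ i, p s i ^ 2 = 1) ∧ ∑ s, w s = 1 ∧
        X = ∑ s, w s • Matrix.vecMulVec (p s) (p s) := by
  obtain ⟨-, hpsd, htr⟩ := hX
  have hH := hpsd.isHermitian
  let e := (Fintype.equivFin {i // 0 < hH.eigenvalues i}).symm
  have sum_pos {M : Type} [AddCommMonoid M] (f : Fin n → M)
      (hf : ∀ i, hH.eigenvalues i = 0 → f i = 0) : ∑ s, f (e s) = ∑ i, f i := by
    rw [e.sum_comp (fun i => f i),
      ← Finset.sum_subtype (Finset.univ.filter fun i => 0 < hH.eigenvalues i) (by simp) f]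
    exact Finset.sum_filter_of_ne fun i _ h =>
      (hpsd.eigenvalues_nonneg i).lt_of_ne' (mt (hf i) h)
  refine ⟨_, fun s => hH.eigenvalues (e s), fun s => hH.eigenvectorBasis (e s),
    fun s => (e s).2, fun s => ?_, ?_, ?_⟩
  · have h := hH.eigenvectorBasis.norm_eq_one (e s)
    rw [EuclideanSpace.norm_eq, Real.sqrt_eq_one] at h
    simpa using h
  · rw [sum_pos hH.eigenvalues (fun _ h => h), ← htr, hH.trace_eq_sum_eigenvalues]
    rfl
  · rw [sum_pos (fun i => hH.eigenvalues i • Matrix.vecMulVec (hH.eigenvectorBasis i)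
      (hH.eigenvectorBasis i)) (fun i h => by simp [h])]
    ext i j
    conv_lhs => rw [hH.spectral_theorem]
    simp [Matrix.sum_apply, Matrix.vecMulVec_apply, Matrix.mul_apply, Matrix.diagonal_apply,
      Unitary.conjStarAlgAut_apply, mul_comm, mul_assoc]

theorem eq_of_weighted_sum_eq {ι : Type*} [Fintype ι] {w f : ι → ℝ} {u : ℝ}
    (hw : ∀ s, 0 < w s) (hsum : ∑ s, w s = 1) (hf : ∀ s, f s ≤ u)
    (h : ∑ s, w s * f s = u) (s : ι) : f s = u := by
  have h' : ∑ s, w s * f s = ∑ s, w s * u := by rw [h, ← Finset.sum_mul, hsum, one_mul]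
  exact mul_left_cancel₀ (hw s).ne' <| (Finset.sum_eq_sum_iff_of_le fun s _ =>
    mul_le_mul_of_nonneg_left (hf s) (hw s).le).1 h' s (Finset.mem_univ s)

theorem nash_equilibrium_characterization {m n : ℕ}
    (A B : Fin m → Fin m → Fin n → Fin n → ℝ)
    (hA : Bisymm A) (hB : Bisymm B)
    (X : Matrix (Fin m) (Fin m) ℝ) (Y : Matrix (Fin n) (Fin n) ℝ) (u v : ℝ) :
    (X ∈ Spectraplex m ∧ Y ∈ Spectraplex n ∧
     u = payoff A X Y ∧ v = payoff B X Y ∧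
     (∀ X' ∈ Spectraplex m, payoff A X' Y ≤ u) ∧
     (∀ Y' ∈ Spectraplex n, payoff B X Y' ≤ v))
    ↔
    ((X ∈ Spectraplex m ∧ ∀ Y' ∈ Spectraplex n, payoff B X Y' ≤ v) ∧
     (Y ∈ Spectraplex n ∧ ∀ X' ∈ Spectraplex m, payoff A X' Y ≤ u) ∧
     (∀ (N M : ℕ) (lam : Fin N → ℝ) (pv : Fin N → Fin m → ℝ)
        (mu : Fin M → ℝ) (qv : Fin M → Fin n → ℝ),
        (∀ s, 0 < lam s) → (∀ s, ∑ i, (pv s i) ^ 2 = 1) → (∑ s, lam s) = 1 →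
        X = ∑ s, lam s • Matrix.vecMulVec (pv s) (pv s) →
        (∀ t, 0 < mu t) → (∀ t, ∑ k, (qv t k) ^ 2 = 1) → (∑ t, mu t) = 1 →
        Y = ∑ t, mu t • Matrix.vecMulVec (qv t) (qv t) →
        (∀ t, payoff B X (Matrix.vecMulVec (qv t) (qv t)) = v) ∧
        (∀ s, payoff A (Matrix.vecMulVec (pv s) (pv s)) Y = u))) := by
  constructor
  · rintro ⟨hX, hY, hu, hv, hXu, hYv⟩
    refine ⟨⟨hX, hYv⟩, ⟨hY, hXu⟩, ?_⟩
    intro N M lam pv mu qv hlam hpv hlam1 hXd hmu hqv hmu1 hYd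
    constructor
    · refine eq_of_weighted_sum_eq hmu hmu1
        (fun t => hYv _ (vecMulVec_self_mem_spectraplex (hqv t))) ?_
      rw [← payoff_sum_right, ← hYd, hv]
    · refine eq_of_weighted_sum_eq hlam hlam1
        (fun s => hXu _ (vecMulVec_self_mem_spectraplex (hpv s))) ?_
      rw [← payoff_sum_left, ← hXd, hu]
  · rintro ⟨⟨hX, hYv⟩, ⟨hY, hXu⟩, h⟩
    obtain ⟨N, lam, pv, hlam, hpv, hlam1, hXd⟩ := exists_rank_one_decomposition hX
    obtain ⟨M, mu, qv, hmu, hqv, hmu1, hYd⟩ := exists_rank_one_decomposition hY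
    obtain ⟨hq, hp⟩ := h N M lam pv mu qv hlam hpv hlam1 hXd hmu hqv hmu1 hYd
    refine ⟨hX, hY, ?_, ?_, hXu, hYv⟩
    · conv_rhs => rw [hXd]
      simp only [payoff_sum_left, hp, ← Finset.sum_mul, hlam1, one_mul]
    · conv_rhs => rw [hYd]
      simp only [payoff_sum_right, hq, ← Finset.sum_mul, hmu1, one_mul]
end

section
/- Let (A, B) be bisymmetric payoff tensors on Sym_m × Sym_n and u, v ∈ ℝ. Suppose X ∈ 𝒳_m with p_B(X,Y') ≤ v for all Y' ∈ 𝒳_n, and Y ∈ 𝒳_n with p_A(X',Y) ≤ u for all X' ∈ 𝒳_m, and suppose there exist finite rank-1 decompositions X = Σ_s λ_s p⁽ˢ⁾(p⁽ˢ⁾)ᵀ and Y = Σ_t μ_t q⁽ᵗ⁾(q⁽ᵗ⁾)ᵀ (with λ_s, μ_t > 0, unit vectors p⁽ˢ⁾, q⁽ᵗ⁾, Σ_s λ_s = Σ_t μ_t = 1) such that p_B(X, q⁽ᵗ⁾(q⁽ᵗ⁾)ᵀ) = v for all t and p_A(p⁽ˢ⁾(p⁽ˢ⁾)ᵀ, Y)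 = u for all s. Then (X, Y) is a Nash equilibrium of the semidefinite game with p_A(X,Y) = u and p_B(X,Y) = v. -/
open Matrix BigOperators

theorem payoff_sum_smul_left {m n N : ℕ} (A : Fin m → Fin m → Fin n → Fin n → ℝ)
    (c : Fin N → ℝ) (P : Fin N → Matrix (Fin m) (Fin m) ℝ) (Y : Matrix (Fin n) (Fin n) ℝ) :
    payoff A (∑ s, c s • P s) Y = ∑ s, c s * payoff A (P s) Y := by
  let f : Matrix (Fin m) (Fin m) ℝ →ₗ[ℝ] ℝ :=
    { toFun := fun X => payoff A X Y
      map_add' := fun X X' => by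
        simp only [payoff, Matrix.add_apply, add_mul, Finset.sum_add_distrib]
      map_smul' := fun r X => by
        simp only [payoff, Matrix.smul_apply, smul_eq_mul, Finset.mul_sum, mul_assoc,
          RingHom.id_apply] }
  change f (∑ s, c s • P s) = ∑ s, c s * f (P s)
  simp only [map_sum, map_smul, smul_eq_mul]

theorem payoff_sum_smul_right {m n N : ℕ} (A : Fin m → Fin m → Fin n → Fin n → ℝ)
    (c : Fin N → ℝ) (X : Matrix (Fin m) (Fin m) ℝ) (Q : Fin N → Matrix (Fin n) (Fin n) ℝ) :
    payoff A X (∑ t, c t • Q t) = ∑ t, c t * payoff A X (Q t) := by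
  let f : Matrix (Fin n) (Fin n) ℝ →ₗ[ℝ] ℝ :=
    { toFun := fun Y => payoff A X Y
      map_add' := fun Y Y' => by
        simp only [payoff, Matrix.add_apply, mul_add, Finset.sum_add_distrib]
      map_smul' := fun r Y => by
        simp only [payoff, Matrix.smul_apply, smul_eq_mul, Finset.mul_sum, mul_left_comm r,
          RingHom.id_apply] }
  change f (∑ t, c t • Q t) = ∑ t, c t * f (Q t)
  simp only [map_sum, map_smul, smul_eq_mul]

theorem nash_from_one_rank_one_decomposition {m n : ℕ}
    (A B : Fin m → Fin m → Fin n → Fin n → ℝ)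
    (hA : Bisymm A) (hB : Bisymm B)
    (X : Matrix (Fin m) (Fin m) ℝ) (Y : Matrix (Fin n) (Fin n) ℝ) (u v : ℝ)
    (hX : X ∈ Spectraplex m) (hY : Y ∈ Spectraplex n)
    (hXv : ∀ Y' ∈ Spectraplex n, payoff B X Y' ≤ v)
    (hYu : ∀ X' ∈ Spectraplex m, payoff A X' Y ≤ u)
    (hdec : ∃ (N M : ℕ) (lam : Fin N → ℝ) (pv : Fin N → Fin m → ℝ)
        (mu : Fin M → ℝ) (qv : Fin M → Fin n → ℝ),
        (∀ s, 0 < lam s) ∧ (∀ s, ∑ i, (pv s i) ^ 2 = 1) ∧ (∑ s, lam s) = 1 ∧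
        X = (∑ s, lam s • Matrix.vecMulVec (pv s) (pv s)) ∧
        (∀ t, 0 < mu t) ∧ (∀ t, ∑ k, (qv t k) ^ 2 = 1) ∧ (∑ t, mu t) = 1 ∧
        Y = (∑ t, mu t • Matrix.vecMulVec (qv t) (qv t)) ∧
        (∀ t, payoff B X (Matrix.vecMulVec (qv t) (qv t)) = v) ∧
        (∀ s, payoff A (Matrix.vecMulVec (pv s) (pv s)) Y = u)) :
    (∀ X' ∈ Spectraplex m, payoff A X' Y ≤ payoff A X Y) ∧
    (∀ Y' ∈ Spectraplex n, payoff B X Y' ≤ payoff B X Y) ∧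
    payoff A X Y = u ∧ payoff B X Y = v := by
  obtain ⟨N, M, lam, pv, mu, qv, -, -, hlam, hXdec, -, -, hmu, hYdec, hv, hu⟩ := hdec
  have hAu : payoff A X Y = u := by
    conv_lhs => rw [hXdec]
    simp only [payoff_sum_smul_left, hu, ← Finset.sum_mul, hlam, one_mul]
  have hBv : payoff B X Y = v := by
    conv_lhs => rw [hYdec]
    simp only [payoff_sum_smul_right, hv, ← Finset.sum_mul, hmu, one_mul]
  exact ⟨fun X' hX' => (hYu X' hX').trans_eq hAu.symm,
    fun Y' hY' => (hXv Y' hY').trans_eq hBv.symm, hAu, hBv⟩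
end

section
/- Let (A, B) with A, B ∈ ℝ^{m×n} be a bimatrix game and let (Ā, B̄) be a semidefinite game on 𝒳_m × 𝒳_n whose bisymmetric payoff tensors satisfy ā_{iikk} = a_{ik} and b̄_{iikk} = b_{ik} for all 1 ≤ i ≤ m, 1 ≤ k ≤ n, as well as ā_{iikl} = b̄_{iikl} = 0 for all i and all k ≠ l, and ā_{ijkk} = b̄_{ijkk} = 0 for all i ≠ j and all k. Then for every Nash equilibrium (x, y) ∈ Δ_m × Δ_n of the bimatrix game (A, B), the pair of diagonal matrices (X, Y) with X = diag(x₁, …, x_m) and Y = diag(y₁, …, y_n) is a Nash equilibrium of the semidefinite game (Ā, B̄). -/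
open Matrix BigOperators

theorem payoff_diagonal_right {m n : ℕ} {A : Fin m → Fin m → Fin n → Fin n → ℝ}
    {a : Matrix (Fin m) (Fin n) ℝ} (hdiag : ∀ i k, A i i k k = a i k)
    (hoff : ∀ i j k, i ≠ j → A i j k k = 0) (X : Matrix (Fin m) (Fin m) ℝ) (y : Fin n → ℝ) :
    payoff A X (diagonal y) = ∑ i, ∑ k, X.diag i * a i k * y k := by
  unfold payoff
  refine Finset.sum_congr rfl fun i _ => ?_
  rw [Finset.sum_eq_single i]
  · simp [diagonal_apply, hdiag]
  · intro j _ hj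
    simp [diagonal_apply, hoff i j _ hj.symm]
  · simp

theorem payoff_diagonal_left {m n : ℕ} {A : Fin m → Fin m → Fin n → Fin n → ℝ}
    {a : Matrix (Fin m) (Fin n) ℝ} (hdiag : ∀ i k, A i i k k = a i k)
    (hoff : ∀ i k l, k ≠ l → A i i k l = 0) (x : Fin m → ℝ) (Y : Matrix (Fin n) (Fin n) ℝ) :
    payoff A (diagonal x) Y = ∑ i, ∑ k, x i * a i k * Y.diag k := by
  unfold payoff
  refine Finset.sum_congr rfl fun i _ => ?_
  rw [Finset.sum_eq_single i]
  · refine Finset.sum_congr rfl fun k _ => ?_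
    rw [Finset.sum_eq_single k]
    · simp [hdiag]
    · intro l _ hl
      simp [hoff i k l hl.symm]
    · simp
  · intro j _ hj
    simp [diagonal_apply_ne _ hj.symm]
  · simp

theorem bimatrix_nash_preserved_in_semidefinite_game {m n : ℕ}
    (a b : Matrix (Fin m) (Fin n) ℝ)
    (Abar Bbar : Fin m → Fin m → Fin n → Fin n → ℝ)
    (hAbi : Bisymm Abar) (hBbi : Bisymm Bbar)
    (hAdiag : ∀ i k, Abar i i k k = a i k) (hBdiag : ∀ i k, Bbar i i k k = b i k)
    (hA0 : ∀ i k l, k ≠ l → Abar i i k l = 0) (hB0 : ∀ i k l, k ≠ l → Bbar i i k l = 0)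
    (hA0' : ∀ i j k, i ≠ j → Abar i j k k = 0) (hB0' : ∀ i j k, i ≠ j → Bbar i j k k = 0)
    (x : Fin m → ℝ) (y : Fin n → ℝ)
    (hx : x ∈ stdSimplex ℝ (Fin m)) (hy : y ∈ stdSimplex ℝ (Fin n))
    (hNashx : ∀ x' ∈ stdSimplex ℝ (Fin m),
      ∑ i, ∑ k, x' i * a i k * y k ≤ ∑ i, ∑ k, x i * a i k * y k)
    (hNashy : ∀ y' ∈ stdSimplex ℝ (Fin n),
      ∑ i, ∑ k, x i * b i k * y' k ≤ ∑ i, ∑ k, x i * b i k * y k) :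
    Matrix.diagonal x ∈ Spectraplex m ∧ Matrix.diagonal y ∈ Spectraplex n ∧
    (∀ X' ∈ Spectraplex m,
      payoff Abar X' (Matrix.diagonal y) ≤
        payoff Abar (Matrix.diagonal x) (Matrix.diagonal y)) ∧
    (∀ Y' ∈ Spectraplex n,
      payoff Bbar (Matrix.diagonal x) Y' ≤
        payoff Bbar (Matrix.diagonal x) (Matrix.diagonal y)) := by
  refine ⟨diagonal_mem_spectraplex hx, diagonal_mem_spectraplex hy, fun X' hX' => ?_,
    fun Y' hY' => ?_⟩
  · rw [payoff_diagonal_right hAdiag hA0', payoff_diagonal_right hAdiag hA0', diag_diagonal]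
    exact hNashx _ (diag_mem_stdSimplex hX')
  · rw [payoff_diagonal_left hBdiag hB0, payoff_diagonal_left hBdiag hB0, diag_diagonal]
    exact hNashy _ (diag_mem_stdSimplex hY')
end

section
/- Block lemma: for k ∈ {1,2}, let G⁽ᵏ⁾ = (A⁽ᵏ⁾, B⁽ᵏ⁾) be a semidefinite game with strategy space 𝒳_{m_k} × 𝒳_{n_k}, let (X⁽ᵏ⁾, Y⁽ᵏ⁾) be a Nash equilibrium of G⁽ᵏ⁾, and write p_A⁽ᵏ⁾ = p_{A⁽ᵏ⁾}(X⁽ᵏ⁾,Y⁽ᵏ⁾) and p_B⁽ᵏ⁾ = p_{B⁽ᵏ⁾}(X⁽ᵏ⁾,Y⁽ᵏ⁾) for the equilibrium payoffs. If α₁, α₂, β₁, β₂ ≥ 0 satisfy α₁ + α₂ = 1, β₁ + β₂ = 1, α₁·p_B⁽¹⁾ = α₂·p_B⁽²⁾ and β₁·p_A⁽¹⁾ = β₂·p_A⁽²⁾, then the pair of block-diagonal matrices X* = diag(α₁X⁽¹⁾, α₂X⁽²⁾) ∈ 𝒳_{m₁+m₂} and Y* = diag(β₁Y⁽¹⁾,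 β₂Y⁽²⁾) ∈ 𝒳_{n₁+n₂} is a Nash equilibrium of the block game of (A⁽¹⁾, B⁽¹⁾) and (A⁽²⁾, B⁽²⁾). -/
open Matrix BigOperators

/-- The spectraplex over a general finite index type: real symmetric positive
semidefinite matrices with trace 1. -/
def SpectraplexI (I : Type*) [Fintype I] : Set (Matrix I I ℝ) :=
  {X | X.IsSymm ∧ X.PosSemidef ∧ X.trace = 1}

/-- The payoff function of a semidefinite game with payoff tensor `A`. -/
def payoffI {I J : Type*} [Fintype I] [Fintype J]
    (A : I → I → J → J → ℝ) (X : Matrix I I ℝ) (Y : Matrix J J ℝ) : ℝ :=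
  ∑ i, ∑ j, ∑ k, ∑ l, X i j * A i j k l * Y k l

/-- A bisymmetric payoff tensor. -/
def BisymmI {I J : Type*} (A : I → I → J → J → ℝ) : Prop :=
  ∀ i j k l, A i j k l = A j i k l ∧ A i j k l = A i j l k

/-- The block tensor with blocks `A1` and `A2`: it coincides with `A1` on the first
blocks of indices, with `A2` on the second blocks, and all other entries are zero. -/
def blockTensor {I₁ I₂ J₁ J₂ : Type*}
    (A1 : I₁ → I₁ → J₁ → J₁ → ℝ) (A2 : I₂ → I₂ → J₂ → J₂ → ℝ) :
    (I₁ ⊕ I₂) → (I₁ ⊕ I₂) → (J₁ ⊕ J₂) → (J₁ ⊕ J₂) → ℝ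
  | Sum.inl i, Sum.inl j, Sum.inl k, Sum.inl l => A1 i j k l
  | Sum.inr i, Sum.inr j, Sum.inr k, Sum.inr l => A2 i j k l
  | _, _, _, _ => 0

theorem payoffI_smul_left {I J : Type*} [Fintype I] [Fintype J]
    (A : I → I → J → J → ℝ) (c : ℝ) (X : Matrix I I ℝ) (Y : Matrix J J ℝ) :
    payoffI A (c • X) Y = c * payoffI A X Y := by
  simp only [payoffI, Finset.mul_sum, Matrix.smul_apply, smul_eq_mul, mul_assoc]

theorem payoffI_smul_right {I J : Type*} [Fintype I] [Fintype J]
    (A : I → I → J → J → ℝ) (c : ℝ) (X : Matrix I I ℝ) (Y : Matrix J J ℝ) :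
    payoffI A X (c • Y) = c * payoffI A X Y := by
  simp only [payoffI, Finset.mul_sum, Matrix.smul_apply, smul_eq_mul, mul_left_comm]

theorem payoffI_blockTensor {I₁ I₂ J₁ J₂ : Type*}
    [Fintype I₁] [Fintype I₂] [Fintype J₁] [Fintype J₂]
    (A1 : I₁ → I₁ → J₁ → J₁ → ℝ) (A2 : I₂ → I₂ → J₂ → J₂ → ℝ)
    (X : Matrix (I₁ ⊕ I₂) (I₁ ⊕ I₂) ℝ) (Y : Matrix (J₁ ⊕ J₂) (J₁ ⊕ J₂) ℝ) :
    payoffI (blockTensor A1 A2) X Y =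
      payoffI A1 X.toBlocks₁₁ Y.toBlocks₁₁ + payoffI A2 X.toBlocks₂₂ Y.toBlocks₂₂ := by
  simp [payoffI, blockTensor, Fintype.sum_sum_type, Matrix.toBlocks₁₁, Matrix.toBlocks₂₂]

/-- A homogeneous function bounded by `c` on the spectraplex is bounded by `c` times the
trace on the cone of positive semidefinite matrices. -/
theorem le_trace_mul_of_forall_mem_spectraplexI {I : Type*} [Fintype I]
    {f : Matrix I I ℝ → ℝ} (hf : ∀ (r : ℝ) (Z : Matrix I I ℝ), f (r • Z) = r * f Z) {c : ℝ}
    (hc : ∀ Z ∈ SpectraplexI I, f Z ≤ c) {Z : Matrix I I ℝ} (hZ : Z.PosSemidef) :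
    f Z ≤ Z.trace * c := by
  rcases hZ.trace_nonneg.eq_or_lt with h | h
  · have h0 : Z = 0 := hZ.trace_eq_zero_iff.mp h.symm
    have hf0 := hf 0 0
    simp only [smul_zero, zero_mul] at hf0
    simp [h0, hf0]
  · have hS : (Z.trace⁻¹ • Z).PosSemidef := hZ.smul (inv_nonneg.mpr h.le)
    have hle := hc (Z.trace⁻¹ • Z)
      ⟨by simpa [Matrix.IsHermitian, Matrix.IsSymm] using hS.isHermitian, hS,
        by simp [Matrix.trace_smul, h.ne']⟩
    rw [hf] at hle
    exact (inv_mul_le_iff₀ h).mp hle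

theorem fromBlocks_smul_mem_spectraplexI {I J : Type*} [Fintype I] [Fintype J]
    {X : Matrix I I ℝ} {Y : Matrix J J ℝ} (hX : X ∈ SpectraplexI I) (hY : Y ∈ SpectraplexI J)
    {a b : ℝ} (ha : 0 ≤ a) (hb : 0 ≤ b) (hab : a + b = 1) :
    Matrix.fromBlocks (a • X) 0 0 (b • Y) ∈ SpectraplexI (I ⊕ J) := by
  have hsymm : (Matrix.fromBlocks (a • X) 0 0 (b • Y)).IsSymm :=
    (hX.1.smul a).fromBlocks (by simp) (hY.1.smul b)
  refine ⟨hsymm, ?_, ?_⟩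
  · refine Matrix.PosSemidef.of_dotProduct_mulVec_nonneg
      (by simpa [Matrix.IsHermitian, Matrix.IsSymm] using hsymm) fun v ↦ ?_
    have h1 := (hX.2.1.smul ha).dotProduct_mulVec_nonneg (v ∘ Sum.inl)
    have h2 := (hY.2.1.smul hb).dotProduct_mulVec_nonneg (v ∘ Sum.inr)
    rw [Matrix.fromBlocks_mulVec]
    simpa [dotProduct, Fintype.sum_sum_type] using add_nonneg h1 h2
  · have hsum : (Matrix.fromBlocks (a • X) 0 0 (b • Y)).trace = (a • X).trace + (b • Y).trace := by
      simp [Matrix.trace, Fintype.sum_sum_type]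
    simp [hsum, Matrix.trace_smul, hX.2.2, hY.2.2, hab]

/-- If `f` and `g` are homogeneous and bounded on the respective spectraplexes by `c` and `d`,
and the weights `a`, `b` equalize `a * c` and `b * d`, then the weighted sum of `f` and `g` over
the diagonal blocks is bounded on the large spectraplex by this common value. -/
theorem weighted_blocks_le {I J : Type*} [Fintype I] [Fintype J]
    {f : Matrix I I ℝ → ℝ} {g : Matrix J J ℝ → ℝ}
    (hf : ∀ (r : ℝ) (Z : Matrix I I ℝ), f (r • Z) = r * f Z)
    (hg : ∀ (r : ℝ) (Z : Matrix J J ℝ), g (r • Z) = r * g Z) {c d a b : ℝ}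
    (hc : ∀ Z ∈ SpectraplexI I, f Z ≤ c) (hd : ∀ Z ∈ SpectraplexI J, g Z ≤ d)
    (ha : 0 ≤ a) (hb : 0 ≤ b) (hab : a * c = b * d)
    {Z : Matrix (I ⊕ J) (I ⊕ J) ℝ} (hZ : Z ∈ SpectraplexI (I ⊕ J)) :
    a * f Z.toBlocks₁₁ + b * g Z.toBlocks₂₂ ≤ a * c := by
  have h1 := mul_le_mul_of_nonneg_left
    (le_trace_mul_of_forall_mem_spectraplexI hf hc (hZ.2.1.submatrix Sum.inl)) ha
  have h2 := mul_le_mul_of_nonneg_left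
    (le_trace_mul_of_forall_mem_spectraplexI hg hd (hZ.2.1.submatrix Sum.inr)) hb
  have ht : (Z.submatrix Sum.inl Sum.inl).trace + (Z.submatrix Sum.inr Sum.inr).trace = 1 := by
    rw [← hZ.2.2]
    simp [Matrix.trace, Fintype.sum_sum_type]
  change a * f (Z.submatrix Sum.inl Sum.inl) + b * g (Z.submatrix Sum.inr Sum.inr) ≤ a * c
  linear_combination h1 + h2 + (a * c) * ht - (Z.submatrix Sum.inr Sum.inr).trace * hab

theorem block_lemma {m₁ m₂ n₁ n₂ : ℕ}
    (A1 B1 : Fin m₁ → Fin m₁ → Fin n₁ → Fin n₁ → ℝ)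
    (A2 B2 : Fin m₂ → Fin m₂ → Fin n₂ → Fin n₂ → ℝ)
    (hA1 : BisymmI A1) (hB1 : BisymmI B1) (hA2 : BisymmI A2) (hB2 : BisymmI B2)
    (X1 : Matrix (Fin m₁) (Fin m₁) ℝ) (Y1 : Matrix (Fin n₁) (Fin n₁) ℝ)
    (X2 : Matrix (Fin m₂) (Fin m₂) ℝ) (Y2 : Matrix (Fin n₂) (Fin n₂) ℝ)
    (hX1 : X1 ∈ SpectraplexI (Fin m₁)) (hY1 : Y1 ∈ SpectraplexI (Fin n₁))
    (hX2 : X2 ∈ SpectraplexI (Fin m₂)) (hY2 : Y2 ∈ SpectraplexI (Fin n₂))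
    (hNash1A : ∀ X' ∈ SpectraplexI (Fin m₁), payoffI A1 X' Y1 ≤ payoffI A1 X1 Y1)
    (hNash1B : ∀ Y' ∈ SpectraplexI (Fin n₁), payoffI B1 X1 Y' ≤ payoffI B1 X1 Y1)
    (hNash2A : ∀ X' ∈ SpectraplexI (Fin m₂), payoffI A2 X' Y2 ≤ payoffI A2 X2 Y2)
    (hNash2B : ∀ Y' ∈ SpectraplexI (Fin n₂), payoffI B2 X2 Y' ≤ payoffI B2 X2 Y2)
    (α₁ α₂ β₁ β₂ : ℝ)
    (hα₁ : 0 ≤ α₁) (hα₂ : 0 ≤ α₂) (hβ₁ : 0 ≤ β₁) (hβ₂ : 0 ≤ β₂)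
    (hαsum : α₁ + α₂ = 1) (hβsum : β₁ + β₂ = 1)
    (hα : α₁ * payoffI B1 X1 Y1 = α₂ * payoffI B2 X2 Y2)
    (hβ : β₁ * payoffI A1 X1 Y1 = β₂ * payoffI A2 X2 Y2) :
    Matrix.fromBlocks (α₁ • X1) 0 0 (α₂ • X2) ∈ SpectraplexI (Fin m₁ ⊕ Fin m₂) ∧
    Matrix.fromBlocks (β₁ • Y1) 0 0 (β₂ • Y2) ∈ SpectraplexI (Fin n₁ ⊕ Fin n₂) ∧
    (∀ X' ∈ SpectraplexI (Fin m₁ ⊕ Fin m₂),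
      payoffI (blockTensor A1 A2) X' (Matrix.fromBlocks (β₁ • Y1) 0 0 (β₂ • Y2)) ≤
      payoffI (blockTensor A1 A2) (Matrix.fromBlocks (α₁ • X1) 0 0 (α₂ • X2))
        (Matrix.fromBlocks (β₁ • Y1) 0 0 (β₂ • Y2))) ∧
    (∀ Y' ∈ SpectraplexI (Fin n₁ ⊕ Fin n₂),
      payoffI (blockTensor B1 B2) (Matrix.fromBlocks (α₁ • X1) 0 0 (α₂ • X2)) Y' ≤
      payoffI (blockTensor B1 B2) (Matrix.fromBlocks (α₁ • X1) 0 0 (α₂ • X2))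
        (Matrix.fromBlocks (β₁ • Y1) 0 0 (β₂ • Y2))) := by
  refine ⟨fromBlocks_smul_mem_spectraplexI hX1 hX2 hα₁ hα₂ hαsum,
    fromBlocks_smul_mem_spectraplexI hY1 hY2 hβ₁ hβ₂ hβsum, fun X' hX' ↦ ?_, fun Y' hY' ↦ ?_⟩
  · have h := weighted_blocks_le (fun r Z ↦ payoffI_smul_left A1 r Z Y1)
      (fun r Z ↦ payoffI_smul_left A2 r Z Y2) hNash1A hNash2A hβ₁ hβ₂ hβ hX'
    simp only [payoffI_blockTensor, Matrix.toBlocks_fromBlocks₁₁, Matrix.toBlocks_fromBlocks₂₂,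
      payoffI_smul_left, payoffI_smul_right]
    linear_combination h + α₂ * hβ - (β₁ * payoffI A1 X1 Y1) * hαsum
  · have h := weighted_blocks_le (fun r Z ↦ payoffI_smul_right B1 r X1 Z)
      (fun r Z ↦ payoffI_smul_right B2 r X2 Z) hNash1B hNash2B hα₁ hα₂ hα hY'
    simp only [payoffI_blockTensor, Matrix.toBlocks_fromBlocks₁₁, Matrix.toBlocks_fromBlocks₂₂,
      payoffI_smul_left, payoffI_smul_right]
    linear_combination h + β₂ * hα - (α₁ * payoffI B1 X1 Y1) * hβsum
end

section
/- Let c > 1/2 and let A be the bisymmetric payoff tensor on Sym_2 × Sym_2 with A_{1111} = 1, A_{2222} = 1, A_{1212} = A_{2112} = A_{1221} = A_{2121} = c, and all other entries 0 (so that p_A(X,Y) = x₁₁y₁₁ + x₂₂y₂₂ + 4c·x₁₂y₁₂), and consider the semidefinite game (A, B) with B = A. Then the set of Nash equilibria of this game is exactly { (X, X) : X ∈ { E₁₁, E₂₂, ½[[1,1],[1,1]], ½[[1,−1],[−1,1]], ½I₂ } }, where E₁₁ = [[1,0],[0,0]], E₂₂ = [[0,0],[0,1]] and I₂ is the 2×2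 identity matrix. In particular, the game has exactly five Nash equilibria. -/
open Matrix BigOperators

/-- The symmetric `2×2` matrix of trace one with Bloch coordinates `u`, `v`. -/
noncomputable def blochMatrix (u v : ℝ) : Matrix (Fin 2) (Fin 2) ℝ :=
  !![(1 + u) / 2, v / 2; v / 2, (1 - u) / 2]

theorem blochMatrix_mem_spectraplex {u v : ℝ} (h : u ^ 2 + v ^ 2 ≤ 1) :
    blochMatrix u v ∈ Spectraplex 2 := by
  have hs : (blochMatrix u v).IsSymm := by
    ext i j
    fin_cases i <;> fin_cases j <;> simp [blochMatrix]
  refine ⟨hs, ?_, ?_⟩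
  · refine Matrix.PosSemidef.of_dotProduct_mulVec_nonneg ?_ ?_
    · exact (Matrix.conjTranspose_eq_transpose_of_trivial _).trans hs
    · intro x
      simp only [blochMatrix, dotProduct, Matrix.mulVec, Fin.sum_univ_two, Pi.star_apply,
        star_trivial, Matrix.of_apply, Matrix.cons_val_zero, Matrix.cons_val_one,
        Matrix.cons_val', Matrix.cons_val_fin_one]
      set a := x 0
      set b := x 1
      have key : (-(u * (a ^ 2 - b ^ 2) + v * (2 * a * b))) ≤ a ^ 2 + b ^ 2 := by
        refine le_of_abs_le (abs_le_of_sq_le_sq ?_ (by positivity))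
        nlinarith [sq_nonneg (u * (2 * a * b) - v * (a ^ 2 - b ^ 2)),
          mul_nonneg (sub_nonneg.2 h) (sq_nonneg (a ^ 2 + b ^ 2))]
      nlinarith
  · simp only [blochMatrix, Matrix.trace_fin_two_of]
    ring

theorem exists_eq_blochMatrix {X : Matrix (Fin 2) (Fin 2) ℝ} (hX : X ∈ Spectraplex 2) :
    ∃ u v : ℝ, u ^ 2 + v ^ 2 ≤ 1 ∧ X = blochMatrix u v := by
  obtain ⟨hs, hp, ht⟩ := hX
  have h10 : X 1 0 = X 0 1 := hs.apply 0 1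
  have hd := hp.det_nonneg
  rw [Matrix.det_fin_two, h10] at hd
  rw [Matrix.trace_fin_two] at ht
  refine ⟨X 0 0 - X 1 1, 2 * X 0 1, ?_, ?_⟩
  · nlinarith
  · ext i j
    fin_cases i <;> fin_cases j <;> simp [blochMatrix, h10] <;> linarith

theorem payoff_blochMatrix {c : ℝ} {A : Fin 2 → Fin 2 → Fin 2 → Fin 2 → ℝ}
    (hA : ∀ i j k l, A i j k l =
      if i = j ∧ k = l ∧ i = k then 1 else if i ≠ j ∧ k ≠ l then c else 0)
    (u v u' v' : ℝ) :
    payoff A (blochMatrix u v) (blochMatrix u' v') = (1 + u * u' + 2 * c * (v * v')) / 2 := by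
  simp [payoff, hA, blochMatrix, Fin.sum_univ_two]
  ring

/-- A maximizer over the unit disc of the linear functional with coefficients `a`, `b` is
a nonnegative multiple of `(a, b)`. -/
theorem sqrt_mul_eq_of_disc_maximizer {u v a b : ℝ} (h : u ^ 2 + v ^ 2 ≤ 1)
    (hmax : ∀ s t : ℝ, s ^ 2 + t ^ 2 ≤ 1 → s * a + t * b ≤ u * a + v * b) :
    √(a ^ 2 + b ^ 2) * u = a ∧ √(a ^ 2 + b ^ 2) * v = b := by
  have hN : √(a ^ 2 + b ^ 2) ^ 2 = a ^ 2 + b ^ 2 := Real.sq_sqrt (by positivity)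
  have hN0 := Real.sqrt_nonneg (a ^ 2 + b ^ 2)
  set N := √(a ^ 2 + b ^ 2)
  have hle : N ^ 2 ≤ N * (u * a + v * b) := by
    rcases hN0.eq_or_lt with h0 | hpos
    · simp [← h0]
    · have h1 := hmax (a / N) (b / N) (by
        rw [div_pow, div_pow, ← add_div, ← hN, div_self (by positivity)])
      have h2 : a / N * a + b / N * b = N := by
        field_simp
        linarith
      rw [h2] at h1
      nlinarith
  have hsum : (N * u - a) ^ 2 + (N * v - b) ^ 2 ≤ 0 := by
    nlinarith [mul_nonneg (sub_nonneg.2 h) (sq_nonneg N)]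
  constructor
  · nlinarith [sq_nonneg (N * u - a), sq_nonneg (N * v - b)]
  · nlinarith [sq_nonneg (N * u - a), sq_nonneg (N * v - b)]

theorem le_of_disc_unit {s t : ℝ} (h : s ^ 2 + t ^ 2 ≤ 1) :
    s ≤ 1 ∧ -1 ≤ s ∧ t ≤ 1 ∧ -1 ≤ t := by
  refine ⟨?_, ?_, ?_, ?_⟩ <;> nlinarith [sq_nonneg s, sq_nonneg t]

theorem eq_of_abs_mul_eq {x y : ℝ} (h : |y| * x = y) (h' : |x| * y = x) :
    x = y ∧ (x = 0 ∨ x = 1 ∨ x = -1) := by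
  rcases abs_cases x with ⟨hx, _⟩ | ⟨hx, _⟩ <;> rcases abs_cases y with ⟨hy, _⟩ | ⟨hy, _⟩ <;>
    rw [hx] at h' <;> rw [hy] at h
  · have hxy : x = y := by linarith
    subst hxy
    refine ⟨rfl, ?_⟩
    rcases eq_or_ne x 0 with h0 | h0
    · exact Or.inl h0
    · exact Or.inr (Or.inl (mul_left_cancel₀ h0 (by linarith)))
  · nlinarith
  · nlinarith
  · have hxy : x = y := by linarith
    subst hxy
    refine ⟨rfl, Or.inr (Or.inr ?_)⟩
    have h0 : x ≠ 0 := by linarith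
    exact mul_left_cancel₀ h0 (by linarith)

theorem disc_equilibrium_cases {k u v u' v' : ℝ} (hk : 1 < k)
    (h : u ^ 2 + v ^ 2 ≤ 1) (h' : u' ^ 2 + v' ^ 2 ≤ 1)
    (hmax : ∀ s t : ℝ, s ^ 2 + t ^ 2 ≤ 1 → s * u' + t * (k * v') ≤ u * u' + v * (k * v'))
    (hmax' : ∀ s t : ℝ, s ^ 2 + t ^ 2 ≤ 1 → s * u + t * (k * v) ≤ u' * u + v' * (k * v)) :
    u = u' ∧ v = v' ∧
      ((u = 0 ∧ (v = 0 ∨ v = 1 ∨ v = -1)) ∨ (v = 0 ∧ (u = 0 ∨ u = 1 ∨ u = -1))) := by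
  obtain ⟨hu, hv⟩ := sqrt_mul_eq_of_disc_maximizer h hmax
  obtain ⟨hu', hv'⟩ := sqrt_mul_eq_of_disc_maximizer h' hmax'
  have hk0 : k ≠ 0 := by linarith
  by_cases h0 : u = 0
  · have h0' : u' = 0 := by rw [← hu, h0, mul_zero]
    subst h0 h0'
    have e (x : ℝ) : √((0 : ℝ) ^ 2 + (k * x) ^ 2) = k * |x| := by
      rw [zero_pow two_ne_zero, zero_add, Real.sqrt_sq_eq_abs, abs_mul,
        abs_of_pos (by linarith : 0 < k)]
    rw [e, mul_assoc] at hv hv'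
    obtain ⟨hvv, hc⟩ := eq_of_abs_mul_eq (mul_left_cancel₀ hk0 hv) (mul_left_cancel₀ hk0 hv')
    exact ⟨rfl, hvv, Or.inl ⟨rfl, hc⟩⟩
  · have hMN : √(u ^ 2 + (k * v) ^ 2) * √(u' ^ 2 + (k * v') ^ 2) = 1 :=
      mul_right_cancel₀ h0 (by rw [mul_assoc, hu, hu', one_mul])
    have hvk : v = k ^ 2 * v := by
      calc v = √(u ^ 2 + (k * v) ^ 2) * (√(u' ^ 2 + (k * v') ^ 2) * v) := by
            rw [← mul_assoc, hMN, one_mul]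
        _ = k * (√(u ^ 2 + (k * v) ^ 2) * v') := by rw [hv]; ring
        _ = k ^ 2 * v := by rw [hv']; ring
    have hv0 : v = 0 := by
      have hz : (k ^ 2 - 1) * v = 0 := by linarith
      exact (mul_eq_zero.1 hz).resolve_left (by nlinarith)
    subst hv0
    have hv0' : v' = 0 := by
      rw [mul_zero] at hv
      exact (mul_eq_zero.1 hv.symm).resolve_left hk0
    subst hv0'
    have e (x : ℝ) : √(x ^ 2 + (k * 0) ^ 2) = |x| := by
      rw [mul_zero, zero_pow two_ne_zero, add_zero, Real.sqrt_sq_eq_abs]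
    rw [e] at hu hu'
    obtain ⟨huu, hc⟩ := eq_of_abs_mul_eq hu hu'
    exact ⟨huu, rfl, Or.inr ⟨rfl, hc⟩⟩

theorem blochMatrix_one_zero : blochMatrix 1 0 = !![(1:ℝ), 0; 0, 0] := by
  norm_num [blochMatrix]

theorem blochMatrix_neg_one_zero : blochMatrix (-1) 0 = !![(0:ℝ), 0; 0, 1] := by
  norm_num [blochMatrix]

theorem blochMatrix_zero_one : blochMatrix 0 1 = !![(1:ℝ)/2, 1/2; 1/2, 1/2] := by
  norm_num [blochMatrix]

theorem blochMatrix_zero_neg_one :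
    blochMatrix 0 (-1) = !![(1:ℝ)/2, -(1/2); -(1/2), 1/2] := by
  norm_num [blochMatrix]

theorem blochMatrix_zero_zero : blochMatrix 0 0 = !![(1:ℝ)/2, 0; 0, 1/2] := by
  norm_num [blochMatrix]

theorem five_nash_equilibria (c : ℝ) (hc : 1 / 2 < c)
    (A : Fin 2 → Fin 2 → Fin 2 → Fin 2 → ℝ)
    (hA : ∀ i j k l, A i j k l =
      if i = j ∧ k = l ∧ i = k then 1 else if i ≠ j ∧ k ≠ l then c else 0) :
    {p : Matrix (Fin 2) (Fin 2) ℝ × Matrix (Fin 2) (Fin 2) ℝ |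
      p.1 ∈ Spectraplex 2 ∧ p.2 ∈ Spectraplex 2 ∧
      (∀ X' ∈ Spectraplex 2, payoff A X' p.2 ≤ payoff A p.1 p.2) ∧
      (∀ Y' ∈ Spectraplex 2, payoff A p.1 Y' ≤ payoff A p.1 p.2)} =
    (fun M => (M, M)) ''
      {!![(1:ℝ), 0; 0, 0], !![(0:ℝ), 0; 0, 1],
       !![(1:ℝ)/2, 1/2; 1/2, 1/2], !![(1:ℝ)/2, -(1/2); -(1/2), 1/2],
       !![(1:ℝ)/2, 0; 0, 1/2]} := by
  rw [← blochMatrix_one_zero, ← blochMatrix_neg_one_zero, ← blochMatrix_zero_one,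
    ← blochMatrix_zero_neg_one, ← blochMatrix_zero_zero]
  ext ⟨X, Y⟩
  constructor
  · rintro ⟨hX, hY, hmax, hmax'⟩
    obtain ⟨u, v, h, rfl⟩ := exists_eq_blochMatrix hX
    obtain ⟨u', v', h', rfl⟩ := exists_eq_blochMatrix hY
    obtain ⟨rfl, rfl, hc⟩ := disc_equilibrium_cases (k := 2 * c) (by linarith) h h'
      (fun s t hst => by
        have := hmax _ (blochMatrix_mem_spectraplex hst)
        simp only [payoff_blochMatrix hA] at this
        linarith)
      (fun s t hst => by
        have := hmax' _ (blochMatrix_mem_spectraplex hst)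
        simp only [payoff_blochMatrix hA] at this
        linarith)
    refine ⟨blochMatrix u v, ?_, rfl⟩
    rcases hc with ⟨rfl, rfl | rfl | rfl⟩ | ⟨rfl, rfl | rfl | rfl⟩ <;> simp
  · rintro ⟨M, hM, hMXY⟩
    obtain ⟨rfl, rfl⟩ := Prod.mk.inj hMXY
    have equilibrium (u v : ℝ) (h : u ^ 2 + v ^ 2 ≤ 1)
        (hmax : ∀ s t : ℝ, s ^ 2 + t ^ 2 ≤ 1 →
          s * u + 2 * c * (t * v) ≤ u * u + 2 * c * (v * v)) :
        blochMatrix u v ∈ Spectraplex 2 ∧ blochMatrix u v ∈ Spectraplex 2 ∧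
        (∀ X' ∈ Spectraplex 2, payoff A X' (blochMatrix u v) ≤
          payoff A (blochMatrix u v) (blochMatrix u v)) ∧
        (∀ Y' ∈ Spectraplex 2, payoff A (blochMatrix u v) Y' ≤
          payoff A (blochMatrix u v) (blochMatrix u v)) := by
      refine ⟨blochMatrix_mem_spectraplex h, blochMatrix_mem_spectraplex h, ?_, ?_⟩ <;>
      · intro Z hZ
        obtain ⟨s, t, hst, rfl⟩ := exists_eq_blochMatrix hZ
        have := hmax s t hst
        simp only [payoff_blochMatrix hA]
        linarith
    rcases hM with rfl | rfl | rfl | rfl | rfl <;>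
    · refine equilibrium _ _ (by norm_num) fun s t hst => ?_
      obtain ⟨h1, h2, h3, h4⟩ := le_of_disc_unit hst
      nlinarith
end
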